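/- In the symmetric group on 16 points {1,…,16}, let g₁ = (1,2,10,9)(3,11,12,4)(5,6,14,13)(7,15,16,8), g₂ = (1,4,12,9)(2,3,11,10)(5,8,16,13)(6,7,15,14), g₃ = (1,5,13,9)(2,6,14,10)(3,7,15,11)(4,8,16,12). Then the subgroup C of Sym(16) generated by g₁, g₂, g₃ has order 192, and the permutation (1,15)(2,16)(3,13)(4,14)(5,11)(6,12)(7,9)(8,10) lies in the center of C. -/

import Mathlib

/-- `(1,2,10,9)(3,11,12,4)(5,6,14,13)(7,15,16,8)` on `{1,…,16}`,
written on `Fin 16 = {0,…,15}` by subtracting 1 from each point. -/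
def permG₁ : Equiv.Perm (Fin 16) :=
  ([0,1,9,8] : List (Fin 16)).formPerm * ([2,10,11,3] : List (Fin 16)).formPerm *
    ([4,5,13,12] : List (Fin 16)).formPerm * ([6,14,15,7] : List (Fin 16)).formPerm

/-- `(1,4,12,9)(2,3,11,10)(5,8,16,13)(6,7,15,14)` on `{1,…,16}`, shifted to `Fin 16`. -/
def permG₂ : Equiv.Perm (Fin 16) :=
  ([0,3,11,8] : List (Fin 16)).formPerm * ([1,2,10,9] : List (Fin 16)).formPerm *
    ([4,7,15,12] : List (Fin 16)).formPerm * ([5,6,14,13] : List (Fin 16)).formPerm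

/-- `(1,5,13,9)(2,6,14,10)(3,7,15,11)(4,8,16,12)` on `{1,…,16}`, shifted to `Fin 16`. -/
def permG₃ : Equiv.Perm (Fin 16) :=
  ([0,4,12,8] : List (Fin 16)).formPerm * ([1,5,13,9] : List (Fin 16)).formPerm *
    ([2,6,14,10] : List (Fin 16)).formPerm * ([3,7,15,11] : List (Fin 16)).formPerm

/-- `(1,15)(2,16)(3,13)(4,14)(5,11)(6,12)(7,9)(8,10)` on `{1,…,16}`, shifted to `Fin 16`. -/
def permZ : Equiv.Perm (Fin 16) :=
  ([0,14] : List (Fin 16)).formPerm * ([1,15] : List (Fin 16)).formPerm *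
    ([2,12] : List (Fin 16)).formPerm * ([3,13] : List (Fin 16)).formPerm *
    ([4,10] : List (Fin 16)).formPerm * ([5,11] : List (Fin 16)).formPerm *
    ([6,8] : List (Fin 16)).formPerm * ([7,9] : List (Fin 16)).formPerm

/-- The self-map of `Fin 16` sending `x` to the hexadecimal digit of `n` in position `x`. -/
def hexDigit (n : ℕ) (x : Fin 16) : Fin 16 :=
  Fin.ofNat 16 (n >>> (4 * (x : ℕ)))

/-- A form of `permG₁` that is fast to evaluate. -/
def hexG₁ : Equiv.Perm (Fin 16) where
  toFun := hexDigit 9206548961053452945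
  invFun := hexDigit 16599602033964397320
  left_inv := by decide +kernel
  right_inv := by decide +kernel

/-- A form of `permG₂` that is fast to evaluate. -/
def hexG₂ : Equiv.Perm (Fin 16) where
  toFun := hexDigit 14795601381899614755
  invFun := hexDigit 8570124327102185880
  left_inv := by decide +kernel
  right_inv := by decide +kernel

/-- A form of `permG₃` that is fast to evaluate. -/
def hexG₃ : Equiv.Perm (Fin 16) where
  toFun := hexDigit 13445551736091342420
  invFun := hexDigit 8526720216205408920
  left_inv := by decide +kernel
  right_inv := by decide +kernel

theorem permG₁_eq_hexG₁ : permG₁ = hexG₁ := by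
  decide +kernel

theorem permG₂_eq_hexG₂ : permG₂ = hexG₂ := by
  decide +kernel

theorem permG₃_eq_hexG₃ : permG₃ = hexG₃ := by
  decide +kernel

/-- Representatives of the left cosets of the stabilizer of `0`. -/
def cosetRep (p : Fin 8 × Fin 2) : Equiv.Perm (Fin 16) :=
  (hexG₁ * hexG₂ * hexG₃) ^ (p.1 : ℕ) * hexG₂ ^ (p.2 : ℕ)

/-- The elements of the stabilizer of `0`, a group isomorphic to `A₄`. -/
def stabElt (q : Fin 3 × Fin 2 × Fin 2) : Equiv.Perm (Fin 16) :=
  (hexG₁ * hexG₂ ^ 3) ^ (q.1 : ℕ) * (hexG₁ * hexG₂ * hexG₃ ^ 3 * hexG₂) ^ (q.2.1 : ℕ) *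
    (hexG₂ * hexG₁ * hexG₃ ^ 3 * hexG₁) ^ (q.2.2 : ℕ)

theorem cosetRep_apply_zero_injective : Function.Injective fun p => cosetRep p 0 := by
  decide +kernel

theorem stabElt_apply_zero (q : Fin 3 × Fin 2 × Fin 2) : stabElt q 0 = 0 := by
  revert q
  decide +kernel

theorem stabElt_injective : Function.Injective stabElt := by
  decide +kernel

theorem exists_stabElt_mul (q r : Fin 3 × Fin 2 × Fin 2) :
    ∃ s, stabElt q * stabElt r = stabElt s := by
  revert q r
  decide +kernel

theorem exists_hexG₁_mul_cosetRep (p : Fin 8 × Fin 2) :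
    ∃ p' q, hexG₁ * cosetRep p = cosetRep p' * stabElt q := by
  revert p
  decide +kernel

theorem exists_hexG₂_mul_cosetRep (p : Fin 8 × Fin 2) :
    ∃ p' q, hexG₂ * cosetRep p = cosetRep p' * stabElt q := by
  revert p
  decide +kernel

theorem exists_hexG₃_mul_cosetRep (p : Fin 8 × Fin 2) :
    ∃ p' q, hexG₃ * cosetRep p = cosetRep p' * stabElt q := by
  revert p
  decide +kernel

theorem permZ_eq : permZ = permG₃ ^ 2 * permG₂ ^ 2 * permG₁ ^ 2 := by
  decide +kernel

theorem cosetRep_mul_stabElt_injective :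
    Function.Injective fun x : (Fin 8 × Fin 2) × (Fin 3 × Fin 2 × Fin 2) =>
      cosetRep x.1 * stabElt x.2 := by
  rintro ⟨p, q⟩ ⟨p', q'⟩ h
  obtain rfl : p = p' := cosetRep_apply_zero_injective <| by
    simpa [stabElt_apply_zero] using Equiv.congr_fun h 0
  exact congrArg _ (stabElt_injective (mul_left_cancel h))

theorem coe_closure_eq_range :
    ((Subgroup.closure {hexG₁, hexG₂, hexG₃} : Subgroup (Equiv.Perm (Fin 16))) :
      Set (Equiv.Perm (Fin 16))) =
      Set.range fun x : (Fin 8 × Fin 2) × (Fin 3 × Fin 2 × Fin 2) =>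
        cosetRep x.1 * stabElt x.2 := by
  have h₁ : hexG₁ ∈ Subgroup.closure {hexG₁, hexG₂, hexG₃} :=
    Subgroup.subset_closure (by simp)
  have h₂ : hexG₂ ∈ Subgroup.closure {hexG₁, hexG₂, hexG₃} :=
    Subgroup.subset_closure (by simp)
  have h₃ : hexG₃ ∈ Subgroup.closure {hexG₁, hexG₂, hexG₃} :=
    Subgroup.subset_closure (by simp)
  refine Set.Subset.antisymm (fun x hx => ?_) ?_
  · rw [SetLike.mem_coe, ← Subgroup.mem_toSubmonoid, Subgroup.closure_toSubmonoid_of_finite] at hx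
    induction hx using Submonoid.closure_induction_left with
    | one => exact ⟨((0, 0), (0, 0, 0)), by simp [cosetRep, stabElt]⟩
    | mul_left g hg y _ ih =>
      obtain ⟨⟨p, q⟩, rfl⟩ := ih
      have key : ∃ p' r, g * cosetRep p = cosetRep p' * stabElt r := by
        rcases hg with rfl | rfl | rfl
        exacts [exists_hexG₁_mul_cosetRep p, exists_hexG₂_mul_cosetRep p,
          exists_hexG₃_mul_cosetRep p]
      obtain ⟨p', r, h⟩ := key
      obtain ⟨s, hs⟩ := exists_stabElt_mul r q
      exact ⟨(p', s), by simp only [← hs, ← mul_assoc, h]⟩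
  · rintro _ ⟨⟨p, q⟩, rfl⟩
    simp only [cosetRep, stabElt, SetLike.mem_coe]
    exact mul_mem (mul_mem (pow_mem (mul_mem (mul_mem h₁ h₂) h₃) _) (pow_mem h₂ _))
      (mul_mem (mul_mem (pow_mem (mul_mem h₁ (pow_mem h₂ 3)) _)
        (pow_mem (mul_mem (mul_mem (mul_mem h₁ h₂) (pow_mem h₃ 3)) h₂) _))
        (pow_mem (mul_mem (mul_mem (mul_mem h₂ h₁) (pow_mem h₃ 3)) h₁) _))

theorem stmt_15 :
    let C : Subgroup (Equiv.Perm (Fin 16)) := Subgroup.closure {permG₁, permG₂, permG₃}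
    Nat.card C = 192 ∧ permZ ∈ C ∧ ∀ x ∈ C, permZ * x = x * permZ := by
  intro C
  refine ⟨?_, ?_, fun x hx => ?_⟩
  · rw [← SetLike.coe_sort_coe, show C = Subgroup.closure {hexG₁, hexG₂, hexG₃} by
        rw [← permG₁_eq_hexG₁, ← permG₂_eq_hexG₂, ← permG₃_eq_hexG₃],
      coe_closure_eq_range, Nat.card_range_of_injective cosetRep_mul_stabElt_injective]
    simp
  · rw [permZ_eq]
    refine mul_mem (mul_mem ?_ ?_) ?_ <;> exact pow_mem (Subgroup.subset_closure (by simp)) 2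
  · have hC : C ≤ Subgroup.centralizer {permZ} := by
      rw [Subgroup.closure_le]
      rintro _ (rfl | rfl | rfl) <;> rw [SetLike.mem_coe, Subgroup.mem_centralizer_singleton_iff] <;>
        decide +kernel
    exact (Subgroup.mem_centralizer_singleton_iff.1 (hC hx)).symm
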